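/- arXiv:2107.09272 — 7 statements merged into one kernel-verified Lean document; each statement's English description precedes it below -/
import Mathlib

section
/- Let G be a nontrivial group with a left-invariant linear order <, and let H = {h ∈ G : h < 1} and H̄ = {h ∈ G : h ≤ 1}. If C₁ and C₂ are order divisions of G with C₁ ⊊ C₂, then there exists g ∈ G with g ∈ C₂ and g ∉ C₁ such that C₁ ⊆ gH and gH̄ ⊆ C₂; in particular C₁ ⊆ gH ⊊ gH̄ ⊆ C₂, so the countable family {gH, gH̄ : g ∈ G} weakly separates any two distinct order divisions. (Interpolation claim in the proof of the order-preserving embedding lemma, Subsection 4.2 of the paper.) -/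
/-- An *order division* of a left-ordered group `G` is a nonempty proper subset
`C ⊊ G` that is downward closed: whenever `a ∈ C` and `b < a`, then `b ∈ C`. -/
def IsOrderDivision {G : Type*} [Group G] [LinearOrder G] (C : Set G) : Prop :=
  C.Nonempty ∧ C ≠ Set.univ ∧ ∀ a ∈ C, ∀ b : G, b < a → b ∈ C

/-- Interpolation claim (Subsection 4.2): if `C₁ ⊊ C₂` are order divisions, then
there is `g ∈ C₂ − C₁` with `C₁ ⊆ gH ⊊ gH̄ ⊆ C₂`, where `H = {h < 1}` and
`H̄ = {h ≤ 1}`. -/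
theorem orderDivision_interpolation {G : Type*} [Group G] [LinearOrder G]
    [CovariantClass G G (· * ·) (· < ·)] [Nontrivial G]
    (C₁ C₂ : Set G) (h₁ : IsOrderDivision C₁) (h₂ : IsOrderDivision C₂)
    (hlt : C₁ ⊂ C₂) :
    ∃ g : G, g ∈ C₂ ∧ g ∉ C₁ ∧
      C₁ ⊆ (g * ·) '' {h : G | h < 1} ∧
      (g * ·) '' {h : G | h < 1} ⊂ (g * ·) '' {h : G | h ≤ 1} ∧
      (g * ·) '' {h : G | h ≤ 1} ⊆ C₂ := by
  obtain ⟨hsub, hnot⟩ := hlt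
  obtain ⟨g, hg₂, hg₁⟩ := Set.not_subset.mp hnot
  have mul_lt {a b : G} (c : G) (h : a < b) : c * a < c * b := CovariantClass.elim c h
  refine ⟨g, hg₂, hg₁, fun c hc => ?_, ?_, ?_⟩
  · have hcg : c < g := by
      rcases lt_trichotomy c g with h | rfl | h
      · exact h
      · exact absurd hc hg₁
      · exact absurd (h₁.2.2 c hc g h) hg₁
    refine ⟨g⁻¹ * c, ?_, mul_inv_cancel_left g c⟩
    simpa using mul_lt g⁻¹ hcg
  · refine ⟨Set.image_mono fun h hh => le_of_lt hh, fun hle => ?_⟩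
    obtain ⟨h, hh, heq⟩ := hle ⟨1, le_refl (1 : G), rfl⟩
    exact ne_of_lt hh (mul_left_cancel heq)
  · rintro _ ⟨h, hh, rfl⟩
    rcases lt_or_eq_of_le (show h ≤ 1 from hh) with hlt | rfl
    · exact h₂.2.2 g hg₂ _ (by simpa using mul_lt g hlt)
    · simpa using hg₂
end

section
/- Let G be a countable nontrivial group with a left-invariant linear order <. Then there exists an injective map e : 𝒞 → ℝ that is order-preserving with respect to strict inclusion on 𝒞 and the usual order on ℝ (i.e., for all X, Y ∈ 𝒞, e(X) < e(Y) if and only if X ⊊ Y) and is unbounded on both sides: for every N > 0 there exist C₁, C₂ ∈ 𝒞 with e(C₁) > N and e(C₂) < −N. (Lemma on order-preserving embeddings, Subsection 4.2 of the paper.) -/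
/-- A nontrivial left-ordered group contains an element greater than the identity. -/
theorem exists_one_lt_of_leftOrdered {G : Type*} [Group G] [LinearOrder G]
    [CovariantClass G G (· * ·) (· < ·)] [Nontrivial G] : ∃ p : G, 1 < p := by
  obtain ⟨a, ha⟩ := exists_ne (1 : G)
  rcases lt_or_gt_of_ne ha with h | h
  · exact ⟨a⁻¹, one_lt_inv_of_inv h⟩
  · exact ⟨a, h⟩

/-- The total weight of a set, for a strictly positive summable weight, is strictly monotone. -/
theorem tsum_subtype_lt_of_ssubset {α : Type*} {w : α → ℝ} (hw : ∀ a, 0 < w a)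
    (hs : Summable w) {A B : Set α} (h : A ⊂ B) : ∑' a : A, w a < ∑' a : B, w a := by
  obtain ⟨b, hbB, hbA⟩ := Set.exists_of_ssubset h
  rw [tsum_subtype, tsum_subtype]
  refine Summable.tsum_lt_tsum (i := b)
    (Set.indicator_le_indicator_of_subset h.subset fun a => (hw a).le) ?_
    (hs.indicator A) (hs.indicator B)
  simpa [hbA, hbB] using hw b

/-- The total weight of a nonempty set is positive. -/
theorem tsum_subtype_pos_of_nonempty {α : Type*} {w : α → ℝ} (hw : ∀ a, 0 < w a)
    (hs : Summable w) {A : Set α} (h : A.Nonempty) : 0 < ∑' a : A, w a := by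
  simpa using tsum_subtype_lt_of_ssubset hw hs (Set.empty_ssubset.2 h)

/-- If `A` is disjoint from a large enough finite set while `B` contains a fixed nonempty set, then
the difference of the reciprocal weights of `A` and `B` is arbitrarily large. -/
theorem exists_finset_lt_inv_tsum_sub_inv_tsum {α : Type*} {w : α → ℝ} (hw : ∀ a, 0 < w a)
    (hs : Summable w) {B₀ : Set α} (hB₀ : B₀.Nonempty) (N : ℝ) :
    ∃ F : Finset α, ∀ A B : Set α, A.Nonempty → Disjoint A F → B₀ ⊆ B →
      N < (∑' a : A, w a)⁻¹ - (∑' a : B, w a)⁻¹ := by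
  have hc := tsum_subtype_pos_of_nonempty hw hs hB₀
  let K : ℝ := max N 0 + (∑' a : B₀, w a)⁻¹
  have hKpos : 0 < K := add_pos_of_nonneg_of_pos (le_max_right _ _) (inv_pos.2 hc)
  obtain ⟨F, hF⟩ := hs.tsum_vanishing (Iio_mem_nhds (inv_pos.2 hKpos))
  refine ⟨F, fun A B hA hAF hB => ?_⟩
  have hA' := tsum_subtype_pos_of_nonempty hw hs hA
  have hKA : max N 0 + (∑' a : B₀, w a)⁻¹ < (∑' a : A, w a)⁻¹ := (lt_inv_comm₀ hA' hKpos).1 (hF A hAF)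
  have hBB : ∑' a : B₀, w a ≤ ∑' a : B, w a := by
    rcases hB.eq_or_ssubset with rfl | h
    · exact le_rfl
    · exact (tsum_subtype_lt_of_ssubset hw hs h).le
  have := inv_anti₀ hc hBB
  have := le_max_left N 0
  linarith

/-- Lemma (Subsection 4.2): for a countable nontrivial left-ordered group `G`,
there is an injective, order-preserving (with respect to `⊊` and `<` on `ℝ`)
map `e : 𝒞 → ℝ` that is unbounded on both sides. -/
theorem exists_orderPreserving_embedding {G : Type*} [Group G] [LinearOrder G]
    [CovariantClass G G (· * ·) (· < ·)] [Countable G] [Nontrivial G] :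
    ∃ e : Set G → ℝ,
      Set.InjOn e {C : Set G | IsOrderDivision C} ∧
      (∀ X : Set G, IsOrderDivision X → ∀ Y : Set G, IsOrderDivision Y →
        (e X < e Y ↔ X ⊂ Y)) ∧
      ∀ N : ℝ, 0 < N →
        (∃ C₁ : Set G, IsOrderDivision C₁ ∧ e C₁ > N) ∧
        (∃ C₂ : Set G, IsOrderDivision C₂ ∧ e C₂ < -N) := by
  classical
  obtain ⟨p, hp⟩ := exists_one_lt_of_leftOrdered (G := G)
  have : NoMaxOrder G := ⟨fun g => ⟨g * p, lt_mul_of_one_lt_right' g hp⟩⟩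
  have : NoMinOrder G := ⟨fun g => ⟨g * p⁻¹, mul_lt_of_lt_one_right' g (Left.inv_lt_one_iff.2 hp)⟩⟩
  have := Encodable.ofCountable G
  obtain ⟨w, hw, _, hsum, _⟩ := posSumOfEncodable (zero_lt_one' ℝ) G
  have hs := hsum.summable
  have mono : ∀ X Y : Set G, IsOrderDivision X → IsOrderDivision Y → X ⊂ Y →
      (∑' a : ↥Xᶜ, w a)⁻¹ - (∑' a : X, w a)⁻¹ < (∑' a : ↥Yᶜ, w a)⁻¹ - (∑' a : Y, w a)⁻¹ := by
    intro X Y hX hY h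
    exact sub_lt_sub
      (inv_strictAnti₀ (tsum_subtype_pos_of_nonempty hw hs (Set.nonempty_compl.2 hY.2.1))
        (tsum_subtype_lt_of_ssubset hw hs (compl_lt_compl_iff_lt.2 h)))
      (inv_strictAnti₀ (tsum_subtype_pos_of_nonempty hw hs hX.1)
        (tsum_subtype_lt_of_ssubset hw hs h))
  have lower : ∀ X : Set G, IsOrderDivision X → IsLowerSet X := fun X hX a b hba ha =>
    hba.eq_or_lt.elim (fun h => h ▸ ha) (hX.2.2 a ha b)
  have tri : ∀ X Y : Set G, IsOrderDivision X → IsOrderDivision Y → X ⊂ Y ∨ X = Y ∨ Y ⊂ X := by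
    intro X Y hX hY
    rcases (lower X hX).total (lower Y hY) with h | h
    · exact h.eq_or_ssubset.elim (fun h => .inr (.inl h)) .inl
    · exact h.eq_or_ssubset.elim (fun h => .inr (.inl h.symm)) fun h => .inr (.inr h)
  refine ⟨fun C => (∑' a : ↥Cᶜ, w a)⁻¹ - (∑' a : C, w a)⁻¹, ?_, ?_, fun N _ => ⟨?_, ?_⟩⟩
  · intro X hX Y hY h
    rcases tri X Y hX hY with h' | h' | h'
    · exact absurd h (mono X Y hX hY h').ne
    · exact h'
    · exact absurd h (mono Y X hY hX h').ne'
  · refine fun X hX Y hY => ⟨fun h => ?_, mono X Y hX hY⟩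
    rcases tri X Y hX hY with h' | rfl | h'
    · exact h'
    · exact absurd h (lt_irrefl _)
    · exact absurd h (mono Y X hY hX h').not_gt
  · obtain ⟨F, hF⟩ := exists_finset_lt_inv_tsum_sub_inv_tsum hw hs
      (Set.nonempty_Iic (a := (1 : G))) N
    obtain ⟨M, hM⟩ := (insert 1 F).bddAbove
    have hne : (Set.Iic M)ᶜ.Nonempty := by
      rw [Set.compl_Iic]
      exact Set.nonempty_Ioi
    refine ⟨Set.Iic M, ⟨Set.nonempty_Iic, Set.nonempty_compl.1 hne,
      fun a ha b hb => hb.le.trans ha⟩, hF _ _ hne ?_ (Set.Iic_subset_Iic.2 (hM (by simp)))⟩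
    exact Set.disjoint_left.2 fun a ha haF => ha (hM (by simp [Finset.mem_coe.1 haF]))
  · obtain ⟨F, hF⟩ := exists_finset_lt_inv_tsum_sub_inv_tsum hw hs
      (Set.nonempty_Ici (a := (1 : G))) N
    obtain ⟨m, hm⟩ := (insert 1 F).bddBelow
    have hsub : Set.Ici 1 ⊆ (Set.Iio m)ᶜ := by
      rw [Set.compl_Iio]
      exact Set.Ici_subset_Ici.2 (hm (by simp))
    refine ⟨Set.Iio m, ⟨Set.nonempty_Iio, Set.nonempty_compl.1 (Set.nonempty_Ici.mono hsub),
      fun a ha b hb => hb.trans ha⟩, ?_⟩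
    have := hF (Set.Iio m) (Set.Iio m)ᶜ Set.nonempty_Iio
      (Set.disjoint_left.2 fun a ha haF =>
        (hm (by simp [Finset.mem_coe.1 haF])).not_gt ha) hsub
    linarith
end

section
/- Let G be a countable nontrivial group with a left-invariant linear order <. Then there exists an embedding map e : 𝒞 → ℝ (injective, order-preserving with respect to ⊊ and the usual order on ℝ, and unbounded on both sides) with the following additional equivariance property: for every h ∈ G, if C₁ ∈ 𝒞 is an upward gap place with respect to e then hC₁ is an upward gap place with respect to e, and if C₂ ∈ 𝒞 is a downward gap place with respect to e then hC₂ is a downward gap place with respect to e. (Modification lemma, Subsection 4.2 of the paper.) -/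
/-- An *embedding map* for the set `𝒞` of order divisions of `G` is a map
`e : Set G → ℝ` that, on order divisions, is injective, order-preserving with
respect to `⊊` and `<`, and unbounded on both sides. -/
def IsEmbeddingMap {G : Type*} [Group G] [LinearOrder G] (e : Set G → ℝ) : Prop :=
  Set.InjOn e {C : Set G | IsOrderDivision C} ∧
  (∀ X : Set G, IsOrderDivision X → ∀ Y : Set G, IsOrderDivision Y →
    (e X < e Y ↔ X ⊂ Y)) ∧
  ∀ N : ℝ, 0 < N →
    (∃ C₁ : Set G, IsOrderDivision C₁ ∧ e C₁ > N) ∧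
    (∃ C₂ : Set G, IsOrderDivision C₂ ∧ e C₂ < -N)

/-- `e⁻(C) = sup {e(X) : X ∈ 𝒞, X ⊊ C}`. -/
noncomputable def eMinus {G : Type*} [Group G] [LinearOrder G]
    (e : Set G → ℝ) (C : Set G) : ℝ :=
  sSup (e '' {X : Set G | IsOrderDivision X ∧ X ⊂ C})

/-- `e⁺(C) = inf {e(X) : X ∈ 𝒞, C ⊊ X}`. -/
noncomputable def ePlus {G : Type*} [Group G] [LinearOrder G]
    (e : Set G → ℝ) (C : Set G) : ℝ :=
  sInf (e '' {X : Set G | IsOrderDivision X ∧ C ⊂ X})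

/-- `C` is an *upward gap place* with respect to `e` if `e(C) > e⁻(C)`. -/
def UpwardGapPlace {G : Type*} [Group G] [LinearOrder G]
    (e : Set G → ℝ) (C : Set G) : Prop :=
  eMinus e C < e C

/-- `C` is a *downward gap place* with respect to `e` if `e(C) < e⁺(C)`. -/
def DownwardGapPlace {G : Type*} [Group G] [LinearOrder G]
    (e : Set G → ℝ) (C : Set G) : Prop :=
  e C < ePlus e C

section OrderDivision

variable {G : Type*} [Group G] [LinearOrder G]

theorem IsOrderDivision.mem_of_le {C : Set G} (hC : IsOrderDivision C) {a b : G} (ha : a ∈ C)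
    (hba : b ≤ a) : b ∈ C := by
  rcases hba.eq_or_lt with rfl | h
  · exact ha
  · exact hC.2.2 a ha b h

theorem IsOrderDivision.lt_of_notMem {C : Set G} (hC : IsOrderDivision C) {a b : G} (ha : a ∈ C)
    (hb : b ∉ C) : a < b :=
  lt_of_not_ge fun h => hb (hC.mem_of_le ha h)

theorem IsOrderDivision.subset_total {X Y : Set G} (hX : IsOrderDivision X)
    (hY : IsOrderDivision Y) : X ⊆ Y ∨ Y ⊆ X := by
  by_contra! h
  obtain ⟨⟨x, hx, hxY⟩, y, hy, hyX⟩ := Set.not_subset.1 h.1, Set.not_subset.1 h.2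
  exact (hX.lt_of_notMem hx hyX).asymm (hY.lt_of_notMem hy hxY)

theorem isOrderDivision_Iic [NoMaxOrder G] (g : G) : IsOrderDivision (Set.Iic g) := by
  refine ⟨⟨g, le_rfl⟩, fun h => ?_, fun a ha b hb => hb.le.trans ha⟩
  obtain ⟨b, hb⟩ := exists_gt g
  exact hb.not_ge (h ▸ Set.mem_univ b : b ∈ Set.Iic g)

theorem isOrderDivision_Iio [NoMinOrder G] (g : G) : IsOrderDivision (Set.Iio g) := by
  refine ⟨exists_lt g, fun h => ?_, fun a ha b hb => hb.trans ha⟩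
  exact lt_irrefl g (h ▸ Set.mem_univ g : g ∈ Set.Iio g)

theorem IsOrderDivision.Iic_ssubset {C : Set G} (hC : IsOrderDivision C)
    (h : ¬ ∃ g, IsGreatest C g) {g : G} (hg : g ∈ C) : Set.Iic g ⊂ C := by
  refine ⟨fun x hx => hC.mem_of_le hg hx, fun h' => h ⟨g, hg, h'⟩⟩

theorem IsOrderDivision.ssubset_Iio {C : Set G} (hC : IsOrderDivision C)
    (h : ¬ ∃ g, IsLeast Cᶜ g) {g : G} (hg : g ∉ C) : C ⊂ Set.Iio g := by
  refine ⟨fun x hx => hC.lt_of_notMem hx hg, fun h' => h ⟨g, hg, fun x hx => ?_⟩⟩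
  exact le_of_not_gt fun hlt => hx (h' hlt)

theorem upwardGapPlace_iff [NoMinOrder G] {e : Set G → ℝ} (he : IsEmbeddingMap e)
    (happrox : ∀ C, IsOrderDivision C → (¬ ∃ g, IsGreatest C g) → ∀ r < e C,
      ∃ X, IsOrderDivision X ∧ X ⊂ C ∧ r < e X)
    {C : Set G} (hC : IsOrderDivision C) :
    UpwardGapPlace e C ↔ ∃ g, IsGreatest C g := by
  constructor
  · intro h
    by_contra hg
    obtain ⟨X, hX, hXC, hlt⟩ := happrox C hC hg _ h
    refine hlt.not_ge (le_csSup ⟨e C, ?_⟩ ⟨X, ⟨hX, hXC⟩, rfl⟩)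
    rintro _ ⟨Y, ⟨hY, hYC⟩, rfl⟩
    exact ((he.2.1 Y hY C hC).2 hYC).le
  · rintro ⟨g, hg, hmax⟩
    have hI := isOrderDivision_Iio g
    have hIC : Set.Iio g ⊂ C := ⟨fun x hx => hC.mem_of_le hg hx.le, fun h => lt_irrefl g (h hg)⟩
    refine lt_of_le_of_lt (csSup_le ⟨_, _, ⟨hI, hIC⟩, rfl⟩ ?_) ((he.2.1 _ hI C hC).2 hIC)
    rintro _ ⟨Y, ⟨hY, hYC⟩, rfl⟩
    refine le_of_not_gt fun h => ?_
    have hss := (he.2.1 _ hI Y hY).1 h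
    refine hYC.2 fun x hx => hY.mem_of_le ?_ (hmax hx)
    obtain ⟨y, hy, hyI⟩ := Set.exists_of_ssubset hss
    exact hY.mem_of_le hy (not_lt.1 hyI)

theorem downwardGapPlace_iff [NoMaxOrder G] {e : Set G → ℝ} (he : IsEmbeddingMap e)
    (happrox : ∀ C, IsOrderDivision C → (¬ ∃ g, IsLeast Cᶜ g) → ∀ r > e C,
      ∃ X, IsOrderDivision X ∧ C ⊂ X ∧ e X < r)
    {C : Set G} (hC : IsOrderDivision C) :
    DownwardGapPlace e C ↔ ∃ g, IsLeast Cᶜ g := by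
  constructor
  · intro h
    by_contra hg
    obtain ⟨X, hX, hXC, hlt⟩ := happrox C hC hg _ h
    refine hlt.not_ge (csInf_le ⟨e C, ?_⟩ ⟨X, ⟨hX, hXC⟩, rfl⟩)
    rintro _ ⟨Y, ⟨hY, hYC⟩, rfl⟩
    exact ((he.2.1 C hC Y hY).2 hYC).le
  · rintro ⟨g, hg, hmin⟩
    have hI := isOrderDivision_Iic g
    have hCI : C ⊂ Set.Iic g := ⟨fun x hx => (hC.lt_of_notMem hx hg).le, fun h => hg (h le_rfl)⟩
    refine lt_of_lt_of_le ((he.2.1 C hC _ hI).2 hCI) (le_csInf ⟨_, _, ⟨hI, hCI⟩, rfl⟩ ?_)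
    rintro _ ⟨Y, ⟨hY, hYC⟩, rfl⟩
    refine le_of_not_gt fun h => ?_
    have hss := (he.2.1 Y hY _ hI).1 h
    obtain ⟨y, hy, hyC⟩ := Set.exists_of_ssubset hYC
    exact hss.2 fun x hx => hY.mem_of_le hy (hx.trans (hmin hyC))

end OrderDivision

section Weight

variable {ι : Type*} {w : ι → ℝ}

theorem tsum_indicator_strictMono (hw : ∀ i, 0 < w i) (hs : Summable w) {A B : Set ι}
    (h : A ⊂ B) : ∑' i, A.indicator w i < ∑' i, B.indicator w i := by
  obtain ⟨i, hiB, hiA⟩ := Set.exists_of_ssubset h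
  refine Summable.tsum_lt_tsum (i := i)
    (fun i => Set.indicator_le_indicator_of_subset h.1 (fun i => (hw i).le) i) ?_
    (hs.indicator A) (hs.indicator B)
  simp [hiA, hiB, hw i]

theorem tsum_indicator_compl (hs : Summable w) (A : Set ι) :
    ∑' i, Aᶜ.indicator w i = ∑' i, w i - ∑' i, A.indicator w i := by
  rw [eq_sub_iff_add_eq, ← (hs.indicator Aᶜ).tsum_add (hs.indicator A)]
  congr 1
  ext i
  by_cases h : i ∈ A <;> simp [h]

/-- The weight of a nonempty set is approximated from below by that of a finite nonempty subset. -/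
theorem exists_finset_lt_tsum_indicator (hw : ∀ i, 0 < w i) (hs : Summable w) {A : Set ι}
    (hA : A.Nonempty) {r : ℝ} (hr : r < ∑' i, A.indicator w i) :
    ∃ F : Finset ι, F.Nonempty ∧ ↑F ⊆ A ∧
      ∀ B : Set ι, ↑F ⊆ B → r < ∑' i, B.indicator w i := by
  classical
  obtain ⟨a, ha⟩ := hA
  obtain ⟨F, hF⟩ := ((hs.indicator A).hasSum.eventually (lt_mem_nhds hr)).exists
  refine ⟨insert a (F.filter (· ∈ A)), Finset.insert_nonempty _ _, ?_, fun B hB => ?_⟩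
  · intro x hx
    simp only [Finset.coe_insert, Finset.coe_filter, Set.mem_insert_iff, Set.mem_ofPred_eq] at hx
    rcases hx with rfl | hx
    exacts [ha, hx.2]
  · refine hF.trans_le (le_trans (Finset.sum_le_sum fun i hi => ?_)
      ((hs.indicator B).sum_le_tsum F
        fun i _ => Set.indicator_nonneg (fun i _ => (hw i).le) i))
    by_cases hiA : i ∈ A
    · have hiB : i ∈ B := hB (by simp [hi, hiA])
      simp [hiA, hiB]
    · simpa [hiA] using Set.indicator_nonneg (fun i _ => (hw i).le) i

variable [LinearOrder ι]

theorem exists_Iic_lt_tsum_indicator (hw : ∀ i, 0 < w i) (hs : Summable w) {A : Set ι}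
    (hA : A.Nonempty) {r : ℝ} (hr : r < ∑' i, A.indicator w i) :
    ∃ m ∈ A, r < ∑' i, (Set.Iic m).indicator w i := by
  obtain ⟨F, hne, hFA, hF⟩ := exists_finset_lt_tsum_indicator hw hs hA hr
  exact ⟨F.max' hne, hFA (F.max'_mem hne), hF _ fun x hx => F.le_max' x hx⟩

theorem exists_Iio_tsum_indicator_lt (hw : ∀ i, 0 < w i) (hs : Summable w) {A : Set ι}
    (hA : Aᶜ.Nonempty) {r : ℝ} (hr : ∑' i, A.indicator w i < r) :
    ∃ m ∉ A, ∑' i, (Set.Iio m).indicator w i < r := by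
  have hr' : ∑' i, w i - r < ∑' i, Aᶜ.indicator w i := by
    rw [tsum_indicator_compl hs]; linarith
  obtain ⟨F, hne, hFA, hF⟩ := exists_finset_lt_tsum_indicator hw hs hA hr'
  refine ⟨F.min' hne, hFA (F.min'_mem hne), ?_⟩
  have := hF (Set.Iio (F.min' hne))ᶜ fun x hx => by simpa using F.min'_le x hx
  rw [tsum_indicator_compl hs] at this
  linarith

end Weight

section Stretch

/-- An increasing bijection from the interval `(0, S)` onto the real line. -/
noncomputable def stretch (S x : ℝ) : ℝ := (S - x)⁻¹ - x⁻¹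

theorem stretch_lt_stretch {S x y : ℝ} (hx : 0 < x) (hxy : x < y) (hy : y < S) :
    stretch S x < stretch S y := by
  have h₁ : (S - x)⁻¹ < (S - y)⁻¹ := by gcongr
  have h₂ : y⁻¹ < x⁻¹ := by gcongr
  unfold stretch
  linarith

theorem continuousAt_stretch {S x : ℝ} (hx : 0 < x) (hxS : x < S) :
    ContinuousAt (stretch S) x := by
  unfold stretch
  exact ((continuousAt_const.sub continuousAt_id).inv₀ (sub_pos.2 hxS).ne').sub
    (continuousAt_id.inv₀ hx.ne')

theorem tendsto_stretch_nhdsLT {S : ℝ} (hS : 0 < S) :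
    Filter.Tendsto (stretch S) (nhdsWithin S (Set.Iio S)) Filter.atTop := by
  have h₁ : Filter.Tendsto (fun x : ℝ => (S - x)⁻¹) (nhdsWithin S (Set.Iio S)) Filter.atTop := by
    refine tendsto_inv_nhdsGT_zero.comp (tendsto_nhdsWithin_iff.2 ⟨?_, ?_⟩)
    · have : Filter.Tendsto (fun x : ℝ => S - x) (nhds S) (nhds (S - S)) :=
        tendsto_const_nhds.sub Filter.tendsto_id
      rw [sub_self] at this
      exact this.mono_left nhdsWithin_le_nhds
    · filter_upwards [self_mem_nhdsWithin] with x hx using sub_pos.2 (Set.mem_Iio.1 hx)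
  have h₂ : Filter.Tendsto (fun x : ℝ => -x⁻¹) (nhdsWithin S (Set.Iio S)) (nhds (-S⁻¹)) :=
    (tendsto_inv₀ hS.ne').neg.mono_left nhdsWithin_le_nhds
  exact (h₁.atTop_add h₂).congr fun x => (sub_eq_add_neg _ _).symm

theorem stretch_sub_self (S x : ℝ) : stretch S (S - x) = -stretch S x := by
  simp [stretch]

end Stretch

theorem exists_isEmbeddingMap_approx {G : Type*} [Group G] [LinearOrder G] [Countable G]
    [NoMaxOrder G] [NoMinOrder G] :
    ∃ e : Set G → ℝ, IsEmbeddingMap e ∧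
      (∀ C, IsOrderDivision C → (¬ ∃ g, IsGreatest C g) → ∀ r < e C,
        ∃ X, IsOrderDivision X ∧ X ⊂ C ∧ r < e X) ∧
      (∀ C, IsOrderDivision C → (¬ ∃ g, IsLeast Cᶜ g) → ∀ r > e C,
        ∃ X, IsOrderDivision X ∧ C ⊂ X ∧ e X < r) := by
  have := Encodable.ofCountable G
  obtain ⟨w, hw, c, hc, -⟩ := posSumOfEncodable (one_pos (α := ℝ)) G
  have hs : Summable w := hc.summable
  set s : Set G → ℝ := fun A => ∑' i, A.indicator w i with hs_def
  set S : ℝ := ∑' i, w i with hS_def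
  have s_empty : s ∅ = 0 := by simp [hs_def]
  have s_univ : s Set.univ = S := by simp [hs_def, hS_def]
  have s_lt {A B : Set G} (h : A ⊂ B) : s A < s B := tsum_indicator_strictMono hw hs h
  have s_pos {C : Set G} (hC : IsOrderDivision C) : 0 < s C :=
    s_empty ▸ s_lt (Set.empty_ssubset.2 hC.1)
  have lt_S {C : Set G} (hC : IsOrderDivision C) : s C < S :=
    s_univ ▸ s_lt (Set.ssubset_univ_iff.2 hC.2.1)
  have hS : 0 < S := (s_pos (isOrderDivision_Iic 1)).trans (lt_S (isOrderDivision_Iic 1))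
  have e_lt {X Y : Set G} (hX : IsOrderDivision X) (hY : IsOrderDivision Y) (h : X ⊂ Y) :
      stretch S (s X) < stretch S (s Y) := stretch_lt_stretch (s_pos hX) (s_lt h) (lt_S hY)
  refine ⟨fun C => stretch S (s C), ⟨?_, ?_, ?_⟩, ?_, ?_⟩
  · intro X hX Y hY hXY
    by_contra hne
    rcases IsOrderDivision.subset_total hX hY with h | h
    · exact (e_lt hX hY (h.ssubset_of_ne hne)).ne hXY
    · exact (e_lt hY hX (h.ssubset_of_ne (Ne.symm hne))).ne' hXY
  · intro X hX Y hY
    refine ⟨fun h => ?_, e_lt hX hY⟩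
    have hne : X ≠ Y := by rintro rfl; exact lt_irrefl _ h
    rcases hX.subset_total hY with h' | h'
    · exact h'.ssubset_of_ne hne
    · exact absurd (e_lt hY hX (h'.ssubset_of_ne hne.symm)) h.asymm
  · intro N _
    obtain ⟨l, hl, hl'⟩ := (mem_nhdsLT_iff_exists_Ioo_subset' hS).1
      ((tendsto_stretch_nhdsLT hS).eventually (Filter.eventually_gt_atTop N))
    constructor
    · obtain ⟨m, -, hm⟩ := exists_Iic_lt_tsum_indicator hw hs (A := Set.univ) ⟨1, trivial⟩
        (show l < s Set.univ from s_univ ▸ hl)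
      have hI := isOrderDivision_Iic m
      exact ⟨_, hI, hl' ⟨hm, lt_S hI⟩⟩
    · obtain ⟨m, -, hm⟩ := exists_Iio_tsum_indicator_lt hw hs (A := ∅) ⟨1, by simp⟩
        (show s ∅ < S - l by rw [s_empty]; exact sub_pos.2 hl)
      have hI := isOrderDivision_Iio m
      have hmem : S - s (Set.Iio m) ∈ Set.Ioo l S :=
        ⟨lt_sub_comm.1 hm, sub_lt_self _ (s_pos hI)⟩
      have hN : N < stretch S (S - s (Set.Iio m)) := hl' hmem
      rw [stretch_sub_self] at hN
      exact ⟨_, hI, lt_neg.1 hN⟩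
  · intro C hC hg r hr
    obtain ⟨l, hl, hl'⟩ := exists_Ioc_subset_of_mem_nhds
      ((continuousAt_stretch (s_pos hC) (lt_S hC)).eventually (lt_mem_nhds hr)) ⟨_, s_pos hC⟩
    obtain ⟨m, hmC, hm⟩ := exists_Iic_lt_tsum_indicator hw hs hC.1 hl
    have hss := hC.Iic_ssubset hg hmC
    exact ⟨_, isOrderDivision_Iic m, hss, hl' ⟨hm, (s_lt hss).le⟩⟩
  · intro C hC hg r hr
    obtain ⟨u, hu, hu'⟩ := exists_Ico_subset_of_mem_nhds
      ((continuousAt_stretch (s_pos hC) (lt_S hC)).eventually (gt_mem_nhds hr)) ⟨_, lt_S hC⟩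
    obtain ⟨m, hmC, hm⟩ :=
      exists_Iio_tsum_indicator_lt hw hs (Set.nonempty_compl.2 hC.2.1) hu
    have hss := hC.ssubset_Iio hg hmC
    exact ⟨_, isOrderDivision_Iio m, hss, hu' ⟨(s_lt hss).le, hm⟩⟩

section LeftInvariant

variable {G : Type*} [Group G] [LinearOrder G] [CovariantClass G G (· * ·) (· < ·)]

theorem strictMono_leftMul (h : G) : StrictMono (h * ·) :=
  fun _ _ hab => CovariantClass.elim (μ := (· * ·)) (r := (· < ·)) h hab

theorem exists_one_lt_of_leftInvariant [Nontrivial G] : ∃ a : G, 1 < a := by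
  obtain ⟨a, ha⟩ := exists_ne (1 : G)
  rcases ha.lt_or_gt with h | h
  · exact ⟨a⁻¹, by simpa using strictMono_leftMul a⁻¹ h⟩
  · exact ⟨a, h⟩

theorem noMaxOrder_of_leftInvariant [Nontrivial G] : NoMaxOrder G := by
  obtain ⟨a, ha⟩ := exists_one_lt_of_leftInvariant (G := G)
  exact ⟨fun x => ⟨x * a, by simpa using strictMono_leftMul x ha⟩⟩

theorem noMinOrder_of_leftInvariant [Nontrivial G] : NoMinOrder G := by
  obtain ⟨a, ha⟩ := exists_one_lt_of_leftInvariant (G := G)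
  exact ⟨fun x => ⟨x * a⁻¹, by simpa using strictMono_leftMul (x * a⁻¹) ha⟩⟩

theorem IsOrderDivision.image_leftMul {C : Set G} (hC : IsOrderDivision C) (h : G) :
    IsOrderDivision ((h * ·) '' C) := by
  refine ⟨hC.1.image _, fun hu => hC.2.1 ?_, ?_⟩
  · exact Set.image_injective.2 (mul_right_injective h)
      (hu.trans (Set.image_univ_of_surjective (Group.mulLeft_bijective h).2).symm)
  · rintro _ ⟨a, ha, rfl⟩ b hb
    refine ⟨h⁻¹ * b, hC.2.2 a ha _ ?_, by simp⟩
    simpa using strictMono_leftMul h⁻¹ hb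

end LeftInvariant

/-- Modification lemma (Subsection 4.2): there is an embedding map `e : 𝒞 → ℝ`
whose upward and downward gap places are `G`-equivariant. -/
theorem exists_equivariant_embedding {G : Type*} [Group G] [LinearOrder G]
    [CovariantClass G G (· * ·) (· < ·)] [Countable G] [Nontrivial G] :
    ∃ e : Set G → ℝ, IsEmbeddingMap e ∧
      ∀ h : G, ∀ C : Set G, IsOrderDivision C →
        (UpwardGapPlace e C → UpwardGapPlace e ((h * ·) '' C)) ∧
        (DownwardGapPlace e C → DownwardGapPlace e ((h * ·) '' C)) := by
  have := noMaxOrder_of_leftInvariant (G := G)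
  have := noMinOrder_of_leftInvariant (G := G)
  obtain ⟨e, he, hup, hdown⟩ := exists_isEmbeddingMap_approx (G := G)
  refine ⟨e, he, fun h C hC => ⟨?_, ?_⟩⟩
  · rw [upwardGapPlace_iff he hup hC, upwardGapPlace_iff he hup (hC.image_leftMul h)]
    rintro ⟨g, hg⟩
    exact ⟨h * g, (strictMono_leftMul h).monotone.map_isGreatest hg⟩
  · rw [downwardGapPlace_iff he hdown hC, downwardGapPlace_iff he hdown (hC.image_leftMul h),
      ← Set.image_compl_eq (Group.mulLeft_bijective h)]
    rintro ⟨g, hg⟩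
    exact ⟨h * g, (strictMono_leftMul h).monotone.map_isLeast hg⟩
end

section
/- Let G be a nontrivial group with a left-invariant linear order <, and let e : 𝒞 → ℝ be an embedding map for the set 𝒞 of order divisions of G such that upward gap places and downward gap places with respect to e are G-equivariant (i.e., for every h ∈ G, if C is an upward (resp. downward) gap place then so is hC). If C₀ ∈ 𝒞 is an absolute upward gap place (respectively: an absolute downward gap place, a relative upward gap place, a relative downward gap place) with respect to e, then for every h ∈ G, hC₀ is an absolute upward gap place (respectively: an absolute downward gap place, a relative upward gap place, a relative downward gap place) with respect to e. (Gap-type lemma, Subsection 4.2 of the paper.) -/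
/-- An upward gap place `C` is *absolute* if `e⁻(C) ∈ e(𝒞)`. -/
def AbsoluteUpwardGapPlace {G : Type*} [Group G] [LinearOrder G]
    (e : Set G → ℝ) (C : Set G) : Prop :=
  UpwardGapPlace e C ∧ eMinus e C ∈ e '' {X : Set G | IsOrderDivision X}

/-- An upward gap place `C` is *relative* if `e⁻(C) ∉ e(𝒞)`. -/
def RelativeUpwardGapPlace {G : Type*} [Group G] [LinearOrder G]
    (e : Set G → ℝ) (C : Set G) : Prop :=
  UpwardGapPlace e C ∧ eMinus e C ∉ e '' {X : Set G | IsOrderDivision X}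

/-- A downward gap place `C` is *absolute* if `e⁺(C) ∈ e(𝒞)`. -/
def AbsoluteDownwardGapPlace {G : Type*} [Group G] [LinearOrder G]
    (e : Set G → ℝ) (C : Set G) : Prop :=
  DownwardGapPlace e C ∧ ePlus e C ∈ e '' {X : Set G | IsOrderDivision X}

/-- A downward gap place `C` is *relative* if `e⁺(C) ∉ e(𝒞)`. -/
def RelativeDownwardGapPlace {G : Type*} [Group G] [LinearOrder G]
    (e : Set G → ℝ) (C : Set G) : Prop :=
  DownwardGapPlace e C ∧ ePlus e C ∉ e '' {X : Set G | IsOrderDivision X}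

theorem image_mul_left_ssubset_iff {G : Type*} [Group G] {g : G} {X Y : Set G} :
    (g * ·) '' X ⊂ (g * ·) '' Y ↔ X ⊂ Y := by
  simp only [ssubset_iff_subset_not_subset, Set.image_subset_image_iff (mul_right_injective g)]

theorem image_inv_mul_image_mul {G : Type*} [Group G] (g : G) (X : Set G) :
    (g⁻¹ * ·) '' ((g * ·) '' X) = X := by
  simp only [Set.image_image, inv_mul_cancel_left, Set.image_id']

theorem image_mul_image_inv_mul {G : Type*} [Group G] (g : G) (X : Set G) :
    (g * ·) '' ((g⁻¹ * ·) '' X) = X := by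
  simp only [Set.image_image, mul_inv_cancel_left, Set.image_id']

section OrderDivision

variable {G : Type*} [Group G] [LinearOrder G]

theorem IsOrderDivision.image_mul_left [CovariantClass G G (· * ·) (· < ·)] {C : Set G}
    (hC : IsOrderDivision C) (g : G) : IsOrderDivision ((g * ·) '' C) := by
  obtain ⟨hne, huniv, hlower⟩ := hC
  refine ⟨hne.image _, fun heq => huniv ?_, ?_⟩
  · rw [← image_inv_mul_image_mul g C, heq]
    exact Set.image_univ_of_surjective (mul_left_surjective g⁻¹)
  · rintro _ ⟨a, ha, rfl⟩ b hb
    refine ⟨g⁻¹ * b, hlower a ha _ ?_, by simp⟩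
    simpa using CovariantClass.elim (μ := (· * ·)) (r := (· < ·)) g⁻¹ hb

theorem IsGreatest.image_mul_left [CovariantClass G G (· * ·) (· < ·)] {C Y : Set G}
    (hY : IsGreatest {X : Set G | IsOrderDivision X ∧ X ⊂ C} Y) (g : G) :
    IsGreatest {X : Set G | IsOrderDivision X ∧ X ⊂ (g * ·) '' C} ((g * ·) '' Y) := by
  refine ⟨⟨hY.1.1.image_mul_left g, image_mul_left_ssubset_iff.2 hY.1.2⟩, ?_⟩
  rintro X ⟨hX, hXC⟩
  rw [← image_mul_image_inv_mul g X] at hXC ⊢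
  exact Set.image_mono (hY.2 ⟨hX.image_mul_left g⁻¹, image_mul_left_ssubset_iff.1 hXC⟩)

theorem IsLeast.image_mul_left [CovariantClass G G (· * ·) (· < ·)] {C Y : Set G}
    (hY : IsLeast {X : Set G | IsOrderDivision X ∧ C ⊂ X} Y) (g : G) :
    IsLeast {X : Set G | IsOrderDivision X ∧ (g * ·) '' C ⊂ X} ((g * ·) '' Y) := by
  refine ⟨⟨hY.1.1.image_mul_left g, image_mul_left_ssubset_iff.2 hY.1.2⟩, ?_⟩
  rintro X ⟨hX, hXC⟩
  rw [← image_mul_image_inv_mul g X] at hXC ⊢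
  exact Set.image_mono (hY.2 ⟨hX.image_mul_left g⁻¹, image_mul_left_ssubset_iff.1 hXC⟩)

theorem IsEmbeddingMap.le_iff_subset {e : Set G → ℝ} (he : IsEmbeddingMap e) {X Y : Set G}
    (hX : IsOrderDivision X) (hY : IsOrderDivision Y) : e X ≤ e Y ↔ X ⊆ Y := by
  rw [le_iff_lt_or_eq, he.2.1 X hX Y hY, he.1.eq_iff hX hY]
  exact le_iff_lt_or_eq.symm

theorem IsEmbeddingMap.absoluteUpwardGapPlace_iff {e : Set G → ℝ} (he : IsEmbeddingMap e)
    {C : Set G} (hC : IsOrderDivision C) :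
    AbsoluteUpwardGapPlace e C ↔
      ∃ Y, IsGreatest {X : Set G | IsOrderDivision X ∧ X ⊂ C} Y := by
  constructor
  · rintro ⟨hgap, Y, hY, hYe⟩
    refine ⟨Y, ⟨hY, (he.2.1 Y hY C hC).1 (hYe.trans_lt hgap)⟩, ?_⟩
    rintro X ⟨hX, hXC⟩
    refine (he.le_iff_subset hX hY).1 (hYe ▸ le_csSup ⟨e C, ?_⟩ ⟨X, ⟨hX, hXC⟩, rfl⟩)
    rintro _ ⟨Z, ⟨hZ, hZC⟩, rfl⟩
    exact (he.le_iff_subset hZ hC).2 hZC.subset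
  · rintro ⟨Y, ⟨hY, hYC⟩, hmax⟩
    have heq : eMinus e C = e Y := by
      refine IsGreatest.csSup_eq ⟨⟨Y, ⟨hY, hYC⟩, rfl⟩, ?_⟩
      rintro _ ⟨Z, hZ, rfl⟩
      exact (he.le_iff_subset hZ.1 hY).2 (hmax hZ)
    exact ⟨heq.trans_lt ((he.2.1 Y hY C hC).2 hYC), Y, hY, heq.symm⟩

theorem IsEmbeddingMap.absoluteDownwardGapPlace_iff {e : Set G → ℝ} (he : IsEmbeddingMap e)
    {C : Set G} (hC : IsOrderDivision C) :
    AbsoluteDownwardGapPlace e C ↔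
      ∃ Y, IsLeast {X : Set G | IsOrderDivision X ∧ C ⊂ X} Y := by
  constructor
  · rintro ⟨hgap, Y, hY, hYe⟩
    refine ⟨Y, ⟨hY, (he.2.1 C hC Y hY).1 (hgap.trans_eq hYe.symm)⟩, ?_⟩
    rintro X ⟨hX, hCX⟩
    refine (he.le_iff_subset hY hX).1 (hYe ▸ csInf_le ⟨e C, ?_⟩ ⟨X, ⟨hX, hCX⟩, rfl⟩)
    rintro _ ⟨Z, ⟨hZ, hCZ⟩, rfl⟩
    exact (he.le_iff_subset hC hZ).2 hCZ.subset
  · rintro ⟨Y, ⟨hY, hCY⟩, hmin⟩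
    have heq : ePlus e C = e Y := by
      refine IsLeast.csInf_eq ⟨⟨Y, ⟨hY, hCY⟩, rfl⟩, ?_⟩
      rintro _ ⟨Z, hZ, rfl⟩
      exact (he.le_iff_subset hY hZ.1).2 (hmin hZ)
    exact ⟨((he.2.1 C hC Y hY).2 hCY).trans_eq heq.symm, Y, hY, heq.symm⟩

theorem AbsoluteUpwardGapPlace.image_mul_left [CovariantClass G G (· * ·) (· < ·)]
    {e : Set G → ℝ} (he : IsEmbeddingMap e) {C : Set G} (hC : IsOrderDivision C)
    (hgap : AbsoluteUpwardGapPlace e C) (g : G) :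
    AbsoluteUpwardGapPlace e ((g * ·) '' C) := by
  obtain ⟨Y, hY⟩ := (he.absoluteUpwardGapPlace_iff hC).1 hgap
  exact (he.absoluteUpwardGapPlace_iff (hC.image_mul_left g)).2 ⟨_, hY.image_mul_left g⟩

theorem AbsoluteDownwardGapPlace.image_mul_left [CovariantClass G G (· * ·) (· < ·)]
    {e : Set G → ℝ} (he : IsEmbeddingMap e) {C : Set G} (hC : IsOrderDivision C)
    (hgap : AbsoluteDownwardGapPlace e C) (g : G) :
    AbsoluteDownwardGapPlace e ((g * ·) '' C) := by
  obtain ⟨Y, hY⟩ := (he.absoluteDownwardGapPlace_iff hC).1 hgap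
  exact (he.absoluteDownwardGapPlace_iff (hC.image_mul_left g)).2 ⟨_, hY.image_mul_left g⟩

end OrderDivision

/-- Gap-type lemma (Subsection 4.2): if gap places are `G`-equivariant for `e`,
then so are absolute/relative upward/downward gap places. -/
theorem gapType_equivariant {G : Type*} [Group G] [LinearOrder G]
    [CovariantClass G G (· * ·) (· < ·)] [Nontrivial G]
    (e : Set G → ℝ) (he : IsEmbeddingMap e)
    (hup : ∀ h : G, ∀ C : Set G, IsOrderDivision C →
      UpwardGapPlace e C → UpwardGapPlace e ((h * ·) '' C))
    (hdown : ∀ h : G, ∀ C : Set G, IsOrderDivision C →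
      DownwardGapPlace e C → DownwardGapPlace e ((h * ·) '' C))
    (C₀ : Set G) (hC₀ : IsOrderDivision C₀) (h : G) :
    (AbsoluteUpwardGapPlace e C₀ → AbsoluteUpwardGapPlace e ((h * ·) '' C₀)) ∧
    (AbsoluteDownwardGapPlace e C₀ → AbsoluteDownwardGapPlace e ((h * ·) '' C₀)) ∧
    (RelativeUpwardGapPlace e C₀ → RelativeUpwardGapPlace e ((h * ·) '' C₀)) ∧
    (RelativeDownwardGapPlace e C₀ → RelativeDownwardGapPlace e ((h * ·) '' C₀)) := by
  refine ⟨fun hgap => hgap.image_mul_left he hC₀ h, fun hgap => hgap.image_mul_left he hC₀ h,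
    fun hgap => ⟨hup h C₀ hC₀ hgap.1, fun hmem => hgap.2 ?_⟩,
    fun hgap => ⟨hdown h C₀ hC₀ hgap.1, fun hmem => hgap.2 ?_⟩⟩
  · have habs : AbsoluteUpwardGapPlace e ((h * ·) '' C₀) := ⟨hup h C₀ hC₀ hgap.1, hmem⟩
    have hback := habs.image_mul_left he (hC₀.image_mul_left h) h⁻¹
    rw [image_inv_mul_image_mul] at hback
    exact hback.2
  · have habs : AbsoluteDownwardGapPlace e ((h * ·) '' C₀) := ⟨hdown h C₀ hC₀ hgap.1, hmem⟩
    have hback := habs.image_mul_left he (hC₀.image_mul_left h) h⁻¹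
    rw [image_inv_mul_image_mul] at hback
    exact hback.2
end

section
/- Let G be a nontrivial group with a left-invariant linear order <, and let e : 𝒞 → ℝ be an embedding map for the set 𝒞 of order divisions of G. If C₀ ∈ 𝒞 is a relative upward gap place with respect to e, then ⋃{C ∈ 𝒞 : C ⊊ C₀} = C₀. Dually, if C₀ is a relative downward gap place with respect to e, then ⋂{C ∈ 𝒞 : C₀ ⊊ C} = C₀. (Properties (3) and (4) in the proof of the gap-type lemma, Subsection 4.2 of the paper.) -/
/-- Properties (3)-(4) in the proof of the gap-type lemma (Subsection 4.2):
a relative upward gap place is the union of its strict predecessors in `𝒞`,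
and a relative downward gap place is the intersection of its strict successors. -/
theorem relativeGapPlace_union_inter {G : Type*} [Group G] [LinearOrder G]
    [CovariantClass G G (· * ·) (· < ·)] [Nontrivial G]
    (e : Set G → ℝ) (he : IsEmbeddingMap e)
    (C₀ : Set G) (hC₀ : IsOrderDivision C₀) :
    (RelativeUpwardGapPlace e C₀ →
      ⋃₀ {C : Set G | IsOrderDivision C ∧ C ⊂ C₀} = C₀) ∧
    (RelativeDownwardGapPlace e C₀ →
      ⋂₀ {C : Set G | IsOrderDivision C ∧ C₀ ⊂ C} = C₀) := by
  obtain ⟨-, hlt, hunb⟩ := he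
  have hle : ∀ X, IsOrderDivision X → ∀ Y, IsOrderDivision Y → X ⊆ Y → e X ≤ e Y :=
    fun X hX Y hY hXY => not_lt.1 fun h => ((hlt Y hY X hX).1 h).not_subset hXY
  have hpos : 0 < |e C₀| + 1 := by positivity
  obtain ⟨⟨S, hS, hSe⟩, P, hP, hPe⟩ := hunb _ hpos
  have hCS : C₀ ⊂ S := (hlt C₀ hC₀ S hS).1 (by linarith [le_abs_self (e C₀)])
  have hPC : P ⊂ C₀ := (hlt P hP C₀ hC₀).1 (by linarith [neg_abs_le (e C₀)])
  constructor
  · rintro ⟨-, hrel⟩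
    by_contra hne
    set U := ⋃₀ {C : Set G | IsOrderDivision C ∧ C ⊂ C₀}
    have hUC : U ⊆ C₀ := Set.sUnion_subset fun X hX => hX.2.subset
    have hsub : ∀ X, IsOrderDivision X → X ⊂ C₀ → X ⊆ U :=
      fun X hX hXC => Set.subset_sUnion_of_mem ⟨hX, hXC⟩
    have hUdiv : IsOrderDivision U := by
      refine ⟨hP.1.mono (hsub P hP hPC), fun h => hC₀.2.1 (Set.univ_subset_iff.1 (h ▸ hUC)), ?_⟩
      rintro a ⟨X, hX, haX⟩ b hb
      exact ⟨X, hX, hX.1.2.2 a haX b hb⟩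
    have hgr : IsGreatest (e '' {X : Set G | IsOrderDivision X ∧ X ⊂ C₀}) (e U) := by
      refine ⟨⟨U, ⟨hUdiv, hUC.ssubset_of_ne hne⟩, rfl⟩, ?_⟩
      rintro _ ⟨X, ⟨hX, hXC⟩, rfl⟩
      exact hle X hX U hUdiv (hsub X hX hXC)
    exact hrel ⟨U, hUdiv, hgr.csSup_eq.symm⟩
  · rintro ⟨-, hrel⟩
    by_contra hne
    set I := ⋂₀ {C : Set G | IsOrderDivision C ∧ C₀ ⊂ C}
    have hCI : C₀ ⊆ I := Set.subset_sInter fun X hX => hX.2.subset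
    have hsub : ∀ X, IsOrderDivision X → C₀ ⊂ X → I ⊆ X :=
      fun X hX hCX => Set.sInter_subset_of_mem ⟨hX, hCX⟩
    have hIdiv : IsOrderDivision I := by
      refine ⟨hC₀.1.mono hCI,
        fun h => hS.2.1 (Set.univ_subset_iff.1 (h ▸ hsub S hS hCS)), ?_⟩
      exact fun a ha b hb X hX => hX.1.2.2 a (ha X hX) b hb
    have hleast : IsLeast (e '' {X : Set G | IsOrderDivision X ∧ C₀ ⊂ X}) (e I) := by
      refine ⟨⟨I, ⟨hIdiv, hCI.ssubset_of_ne (Ne.symm hne)⟩, rfl⟩, ?_⟩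
      rintro _ ⟨X, ⟨hX, hCX⟩, rfl⟩
      exact hle I hIdiv X hX (hsub X hX hCX)
    exact hrel ⟨I, hIdiv, hleast.csInf_eq.symm⟩
end

section
/- Let G be a group with a left-invariant linear order <, let e : 𝒞 → ℝ be an embedding map for the set 𝒞 of order divisions of G, and let t ∈ ℝ with t ∉ e(𝒞). Set a = sup{e(C) : C ∈ 𝒞, e(C) ≤ t} and b = inf{e(C) : C ∈ 𝒞, e(C) ≥ t}. If a ∉ e(𝒞), then the union C₁ = ⋃{C ∈ 𝒞 : e(C) ≤ t} is an order division of G and e(C₁) = b; in particular b ∈ e(𝒞). (Case 1 of the proof of the interval-type lemma, Subsection 4.2 of the paper.) -/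
/-- Case 1 of the proof of the interval-type lemma (Subsection 4.2): if
`a = sup (e(𝒞) ∩ (-∞, t]) ∉ e(𝒞)`, then `C₁ = ⋃ {C ∈ 𝒞 : e(C) ≤ t}` is an
order division with `e(C₁) = b = inf (e(𝒞) ∩ [t, +∞))`; in particular `b ∈ e(𝒞)`. -/
theorem intervalType_case1 {G : Type*} [Group G] [LinearOrder G]
    [CovariantClass G G (· * ·) (· < ·)]
    (e : Set G → ℝ) (he : IsEmbeddingMap e) (t : ℝ)
    (ht : t ∉ e '' {C : Set G | IsOrderDivision C})
    (ha : sSup (e '' {C : Set G | IsOrderDivision C} ∩ Set.Iic t) ∉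
      e '' {C : Set G | IsOrderDivision C}) :
    IsOrderDivision (⋃₀ {C : Set G | IsOrderDivision C ∧ e C ≤ t}) ∧
    e (⋃₀ {C : Set G | IsOrderDivision C ∧ e C ≤ t}) =
      sInf (e '' {C : Set G | IsOrderDivision C} ∩ Set.Ici t) ∧
    sInf (e '' {C : Set G | IsOrderDivision C} ∩ Set.Ici t) ∈
      e '' {C : Set G | IsOrderDivision C} := by
  obtain ⟨-, hmono, hunb⟩ := he
  have hN : 0 < |t| + 1 := by positivity
  obtain ⟨⟨D, hD, hDt⟩, E, hE, hEt⟩ := hunb _ hN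
  have htD : t ≤ e D := by linarith [le_abs_self t]
  have hEt' : e E ≤ t := by linarith [neg_abs_le t]
  have hle : ∀ X Y : Set G, IsOrderDivision X → IsOrderDivision Y → X ⊆ Y → e X ≤ e Y :=
    fun X Y hX hY hXY => not_lt.1 fun h => ((hmono Y hY X hX).1 h).2 hXY
  have hsub : ∀ Y : Set G, IsOrderDivision Y → t ≤ e Y →
      ⋃₀ {C : Set G | IsOrderDivision C ∧ e C ≤ t} ⊆ Y := by
    rintro Y hY htY
    refine Set.sUnion_subset fun C hC => ((hmono C hC.1 Y hY).1 ?_).1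
    exact (lt_of_le_of_ne hC.2 fun h => ht ⟨C, hC.1, h⟩).trans_le htY
  have hsup : ∀ C : Set G, IsOrderDivision C → e C ≤ t →
      C ⊆ ⋃₀ {C : Set G | IsOrderDivision C ∧ e C ≤ t} :=
    fun C hC hCt => Set.subset_sUnion_of_mem ⟨hC, hCt⟩
  have hU : IsOrderDivision (⋃₀ {C : Set G | IsOrderDivision C ∧ e C ≤ t}) := by
    refine ⟨hE.1.mono (hsup E hE hEt'), fun h => hD.2.1 ?_, ?_⟩
    · exact Set.univ_subset_iff.1 (h ▸ hsub D hD htD)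
    · rintro a ⟨C, hC, haC⟩ b hb
      exact ⟨C, hC, hC.1.2.2 a haC b hb⟩
  have htU : t ≤ e (⋃₀ {C : Set G | IsOrderDivision C ∧ e C ≤ t}) := by
    by_contra! hlt
    have hmax : IsGreatest (e '' {C : Set G | IsOrderDivision C} ∩ Set.Iic t)
        (e (⋃₀ {C : Set G | IsOrderDivision C ∧ e C ≤ t})) := by
      refine ⟨⟨⟨_, hU, rfl⟩, hlt.le⟩, ?_⟩
      rintro _ ⟨⟨C, hC, rfl⟩, hCt⟩
      exact hle _ _ hC hU (hsup C hC hCt)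
    exact ha (hmax.csSup_eq ▸ hmax.1.1)
  have hmin : IsLeast (e '' {C : Set G | IsOrderDivision C} ∩ Set.Ici t)
      (e (⋃₀ {C : Set G | IsOrderDivision C ∧ e C ≤ t})) := by
    refine ⟨⟨⟨_, hU, rfl⟩, htU⟩, ?_⟩
    rintro _ ⟨⟨C, hC, rfl⟩, htC⟩
    exact hle _ _ hU hC (hsub C hC htC)
  exact ⟨hU, hmin.csInf_eq.symm, hmin.csInf_eq ▸ hmin.1.1⟩
end

section
/- Let G be a group with a left-invariant linear order <, let e : 𝒞 → ℝ be an embedding map for the set 𝒞 of order divisions of G, and let t ∈ ℝ with t ∉ e(𝒞). Set a = sup{e(C) : C ∈ 𝒞, e(C) ≤ t} and b = inf{e(C) : C ∈ 𝒞, e(C) ≥ t}. If b ∉ e(𝒞), then the intersection C₂ = ⋂{C ∈ 𝒞 : e(C) ≥ t} is an order division of G and e(C₂) = a; in particular a ∈ e(𝒞). (Case 2 of the proof of the interval-type lemma, Subsection 4.2 of the paper.) -/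
theorem IsOrderDivision.sInter {G : Type*} [Group G] [LinearOrder G] {S : Set (Set G)}
    (hS : ∀ C ∈ S, IsOrderDivision C) (hne : S.Nonempty) (hinter : (⋂₀ S).Nonempty) :
    IsOrderDivision (⋂₀ S) := by
  refine ⟨hinter, fun huniv => ?_, fun a ha b hba C hC => (hS C hC).2.2 a (ha C hC) b hba⟩
  obtain ⟨C, hC⟩ := hne
  exact (hS C hC).2.1 (Set.eq_univ_of_univ_subset (huniv ▸ Set.sInter_subset_of_mem hC))

theorem IsEmbeddingMap.le_of_subset {G : Type*} [Group G] [LinearOrder G] {e : Set G → ℝ}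
    (he : IsEmbeddingMap e) {X Y : Set G} (hX : IsOrderDivision X) (hY : IsOrderDivision Y)
    (hXY : X ⊆ Y) : e X ≤ e Y :=
  not_lt.mp fun h => ((he.2.1 Y hY X hX).mp h).not_subset hXY

/-- Case 2 of the proof of the interval-type lemma (Subsection 4.2): if
`b = inf (e(𝒞) ∩ [t, +∞)) ∉ e(𝒞)`, then `C₂ = ⋂ {C ∈ 𝒞 : e(C) ≥ t}` is an
order division with `e(C₂) = a = sup (e(𝒞) ∩ (-∞, t])`; in particular `a ∈ e(𝒞)`. -/
theorem intervalType_case2 {G : Type*} [Group G] [LinearOrder G]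
    [CovariantClass G G (· * ·) (· < ·)]
    (e : Set G → ℝ) (he : IsEmbeddingMap e) (t : ℝ)
    (ht : t ∉ e '' {C : Set G | IsOrderDivision C})
    (hb : sInf (e '' {C : Set G | IsOrderDivision C} ∩ Set.Ici t) ∉
      e '' {C : Set G | IsOrderDivision C}) :
    IsOrderDivision (⋂₀ {C : Set G | IsOrderDivision C ∧ t ≤ e C}) ∧
    e (⋂₀ {C : Set G | IsOrderDivision C ∧ t ≤ e C}) =
      sSup (e '' {C : Set G | IsOrderDivision C} ∩ Set.Iic t) ∧
    sSup (e '' {C : Set G | IsOrderDivision C} ∩ Set.Iic t) ∈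
      e '' {C : Set G | IsOrderDivision C} := by
  have below : ∀ D, IsOrderDivision D → e D ≤ t →
      D ⊆ ⋂₀ {C : Set G | IsOrderDivision C ∧ t ≤ e C} := fun D hD hDt =>
    Set.subset_sInter fun C hC =>
    ((he.2.1 D hD C hC.1).mp
      ((lt_of_le_of_ne hDt fun h => ht ⟨D, hD, h⟩).trans_le hC.2)).subset
  obtain ⟨⟨C, hC, hCt⟩, D, hD, hDt⟩ := he.2.2 (|t| + 1) (by positivity)
  have hCt' : t ≤ e C := by linarith [le_abs_self t]
  have hDt' : e D ≤ t := by linarith [neg_abs_le t]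
  have hI : IsOrderDivision (⋂₀ {C : Set G | IsOrderDivision C ∧ t ≤ e C}) :=
    .sInter (fun _ h => h.1) ⟨C, hC, hCt'⟩ (hD.1.mono (below D hD hDt'))
  have hIt : e (⋂₀ {C : Set G | IsOrderDivision C ∧ t ≤ e C}) < t := by
    by_contra! h
    have hleast : IsLeast (e '' {C : Set G | IsOrderDivision C} ∩ Set.Ici t)
        (e (⋂₀ {C : Set G | IsOrderDivision C ∧ t ≤ e C})) := by
      refine ⟨⟨⟨_, hI, rfl⟩, h⟩, ?_⟩
      rintro _ ⟨⟨X, hX, rfl⟩, hXt⟩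
      exact he.le_of_subset hI hX (Set.sInter_subset_of_mem ⟨hX, hXt⟩)
    exact hb ⟨_, hI, hleast.csInf_eq.symm⟩
  have hgreatest : IsGreatest (e '' {C : Set G | IsOrderDivision C} ∩ Set.Iic t)
      (e (⋂₀ {C : Set G | IsOrderDivision C ∧ t ≤ e C})) := by
    refine ⟨⟨⟨_, hI, rfl⟩, hIt.le⟩, ?_⟩
    rintro _ ⟨⟨X, hX, rfl⟩, hXt⟩
    exact he.le_of_subset hX hI (below X hX hXt)
  exact ⟨hI, hgreatest.csSup_eq.symm, _, hI, hgreatest.csSup_eq.symm⟩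
end
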